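/- For the natural representation of sl₂(ℂ) on the free Lie algebra L on a, b, the space of Lie invariants of degree 10 has dimension 5, with basis (writing [[ba]b] for [[b,a],b], etc.): J₁₀⁽¹⁾ = [[[[ba]b][ba]][[[ba]a][ba]]]; J₁₀⁽²⁾ = [[[[[ba]a]a]b][[[ba]b][ba]]] − 2[[[[[ba]a]b]b][[[ba]a][ba]]] − 3[[[[[ba]a]b]b][[[[ba]a]a]b]] + [[[[[ba]b]b]b][[[[ba]a]a]a]]; J₁₀⁽³⁾ = [[[[[ba]a]a][ba]][[[ba]b]b]] − 2[[[[[ba]a]b][ba]][[[ba]a]b]] + [[[[[ba]b]b][ba]][[[ba]a]a]]; J₁₀⁽⁴⁾ = [[[[ba]b][[ba]a]][[[ba]a]b]] + [[[[[ba]a]a][[ba]b]][[ba]b]] − 2[[[[[ba]a]b][[ba]a]][[ba]b]] + [[[[[ba]b]b][[ba]a]][[ba]a]]; J₁₀⁽⁵⁾ = −[[[[[ba]a][ba]][ba]][[ba]b]] + [[[[[ba]b][ba]][ba]][[ba]a]]. -/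

import Mathlib

/-!
Setting: the free Lie algebra `FL` over ℂ on two generators `a < b`, with the simple
Lie algebra sl₂(ℂ) (standard basis x, h, y, with ⁅h,x⁆ = 2x, ⁅h,y⁆ = −2y, ⁅x,y⁆ = h)
acting on `FL` by derivations extending its natural representation on the span of the
generators:  x.a = 0, x.b = a, h.a = a, h.b = −b, y.a = b, y.b = 0.
The derivations `X H Y` realizing these actions are uniquely determined by their values
on the generators, so we quantify over derivations with the prescribed generator values.
-/

noncomputable section

/-- The free Lie algebra over ℂ on two generators. -/
abbrev FL : Type := FreeLieAlgebra ℂ (Fin 2)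

/-- The generator `a`. -/
def genA : FL := FreeLieAlgebra.of ℂ 0

/-- The generator `b`. -/
def genB : FL := FreeLieAlgebra.of ℂ 1

/-- Interpret a nonassociative word on the generators as a Lie monomial in `FL`. -/
def magmaToLie : FreeMagma (Fin 2) → FL
  | .of i => FreeLieAlgebra.of ℂ i
  | .mul t u => ⁅magmaToLie t, magmaToLie u⁆

/-- The homogeneous component `L_j`: the span of the Lie monomials of degree `j`. -/
def homog (j : ℕ) : Submodule ℂ FL :=
  Submodule.span ℂ (magmaToLie '' {t | t.length = j})

/-- The weight space `L_j^w`: the eigenspace of the `h`-action on `L_j`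
with eigenvalue `w`. -/
def wtsp (H : LieDerivation ℂ FL FL) (j : ℕ) (w : ℤ) : Submodule ℂ FL :=
  homog j ⊓ Module.End.eigenspace (H.toLinearMap) (w : ℂ)

/-- The space of Lie invariants of degree `j`: elements of `L_j` annihilated by every
element of sl₂(ℂ), equivalently by the actions of the basis elements x, h, y. -/
def invariants (X H Y : LieDerivation ℂ FL FL) (j : ℕ) : Submodule ℂ FL :=
  homog j ⊓ LinearMap.ker X.toLinearMap ⊓ LinearMap.ker H.toLinearMap ⊓
    LinearMap.ker Y.toLinearMap

/-- The Lie subalgebra of `FL` generated by the invariants of degree `< j`.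
An invariant of degree `j` is primitive iff it does not belong to this subalgebra. -/
def lowerInv (X H Y : LieDerivation ℂ FL FL) (j : ℕ) : LieSubalgebra ℂ FL :=
  LieSubalgebra.lieSpan ℂ FL (⋃ i < j, (invariants X H Y i : Set FL))

/-- `[b,a]` -/
def ba : FL := ⁅genB, genA⁆
/-- `[[b,a],a]` -/
def baa : FL := ⁅ba, genA⁆
/-- `[[b,a],b]` -/
def bab : FL := ⁅ba, genB⁆
/-- `[[[b,a],a],a]` -/
def baaa : FL := ⁅baa, genA⁆
/-- `[[[b,a],a],b]` -/
def baab : FL := ⁅baa, genB⁆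
/-- `[[[b,a],b],b]` -/
def babb : FL := ⁅bab, genB⁆

/-- `J₁₀⁽¹⁾ = [[[[ba]b][ba]][[[ba]a][ba]]]` -/
def J1 : FL := ⁅⁅bab, ba⁆, ⁅baa, ba⁆⁆

/-- `J₁₀⁽²⁾` -/
def J2 : FL :=
  ⁅⁅baaa, genB⁆, ⁅bab, ba⁆⁆ - (2 : ℂ) • ⁅⁅baab, genB⁆, ⁅baa, ba⁆⁆
    - (3 : ℂ) • ⁅⁅baab, genB⁆, ⁅baaa, genB⁆⁆ + ⁅⁅babb, genB⁆, ⁅baaa, genA⁆⁆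

/-- `J₁₀⁽³⁾` -/
def J3 : FL :=
  ⁅⁅baaa, ba⁆, babb⁆ - (2 : ℂ) • ⁅⁅baab, ba⁆, baab⁆ + ⁅⁅babb, ba⁆, baaa⁆

/-- `J₁₀⁽⁴⁾` -/
def J4 : FL :=
  ⁅⁅bab, baa⁆, baab⁆ + ⁅⁅baaa, bab⁆, bab⁆ - (2 : ℂ) • ⁅⁅baab, baa⁆, bab⁆
    + ⁅⁅babb, baa⁆, baa⁆

/-- `J₁₀⁽⁵⁾` -/
def J5 : FL := -⁅⁅⁅baa, ba⁆, ba⁆, bab⁆ + ⁅⁅⁅bab, ba⁆, ba⁆, baa⁆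

/-! ### Computable noncommutative polynomials -/

/-- Noncommutative integer polynomials in two letters: `n c l r` stands for `c + a l + b r`. -/
inductive Tr : Type
  | z : Tr
  | n : ℤ → Tr → Tr → Tr

namespace Tr

/-- test for zero, cheap in the kernel -/
def isZ : ℤ → Bool
  | Int.ofNat m => Nat.beq m 0
  | Int.negSucc _ => false

def add (s : Tr) : Tr → Tr :=
  Tr.rec (motive := fun _ => Tr → Tr) (fun t => t)
    (fun c l r fl fr t => Tr.rec (motive := fun _ => Tr) (n c l r)
      (fun d l' r' _ _ => n (Int.add c d) (fl l') (fr r')) t) s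

def smul (k : ℤ) (s : Tr) : Tr :=
  Tr.rec (motive := fun _ => Tr) z (fun c _ _ fl fr => n (Int.mul k c) fl fr) s

def sub (s t : Tr) : Tr := add s (smul (-1) t)

/-- add a constant -/
def addC (c : ℤ) (t : Tr) : Tr := bif isZ c then t else add (n c z z) t

/-- right multiplication by the letter `a` -/
def rA (s : Tr) : Tr :=
  Tr.rec (motive := fun _ => Tr) z (fun c _ _ fl fr => n 0 (addC c fl) fr) s

/-- right multiplication by the letter `b` -/
def rB (s : Tr) : Tr :=
  Tr.rec (motive := fun _ => Tr) z (fun c _ _ fl fr => n 0 fl (addC c fr)) s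

def mul : Tr → Tr → Tr
  | z, _ => z
  | n c l r, t => bif isZ c then n 0 (mul l t) (mul r t)
      else add (smul c t) (n 0 (mul l t) (mul r t))

def br (s t : Tr) : Tr := sub (mul s t) (mul t s)

def isZero (s : Tr) : Bool :=
  Tr.rec (motive := fun _ => Bool) true (fun c _ _ fl fr => isZ c && fl && fr) s

/-- homogeneity of degree `k` -/
def ok : ℕ → Tr → Bool
  | _, z => true
  | 0, n _ l r => isZero l && isZero r
  | k + 1, n c l r => isZ c && ok k l && ok k r

def coef : Tr → List Bool → ℤ
  | z, _ => 0
  | n c _ _, [] => c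
  | n _ l _, false :: w => coef l w
  | n _ _ r, true :: w => coef r w

def tA : Tr := n 0 (n 1 z z) z
def tB : Tr := n 0 z (n 1 z z)
def tba : Tr := br tB tA

/-- the action of the basis elements of sl₂ -/
def XT : Tr → Tr
  | z => z
  | n _ l r => n 0 (add (XT l) r) (XT r)
def YT : Tr → Tr
  | z => z
  | n _ l r => n 0 (YT l) (add l (YT r))
def HT : Tr → Tr
  | z => z
  | n _ l r => n 0 (add (HT l) l) (sub (HT r) r)

/-- the expansion of the combination of right-normed brackets ending in `[b,a]` -/
def RT (s : Tr) : Tr :=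
  Tr.rec (motive := fun _ => Tr) z (fun c _ _ fl fr =>
    add (bif isZ c then z else smul c tba)
      (add (sub (n 0 fl z) (rA fl)) (sub (n 0 z fr) (rB fr)))) s

def word : List Bool → Tr
  | [] => n 1 z z
  | false :: u => n 0 (word u) z
  | true :: u => n 0 z (word u)

/-- the extremal projector (scaled) -/
def PT (t : Tr) : Tr :=
  add (smul 2880 t) (add (smul (-1440) (YT (XT t)))
    (add (smul 240 (YT (YT (XT (XT t))))) (add (smul (-20) (YT (YT (YT (XT (XT (XT t)))))))
      (YT (YT (YT (YT (XT (XT (XT (XT t)))))))))))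

def wt : List Bool → ℤ
  | [] => 0
  | false :: u => 1 + wt u
  | true :: u => -1 + wt u

def tbaa : Tr := br tba tA
def tbab : Tr := br tba tB
def tbaaa : Tr := br tbaa tA
def tbaab : Tr := br tbaa tB
def tbabb : Tr := br tbab tB

def T1 : Tr := br (br tbab tba) (br tbaa tba)
def T2 : Tr :=
  add (sub (sub (br (br tbaaa tB) (br tbab tba)) (smul 2 (br (br tbaab tB) (br tbaa tba))))
    (smul 3 (br (br tbaab tB) (br tbaaa tB)))) (br (br tbabb tB) (br tbaaa tA))
def T3 : Tr :=
  add (sub (br (br tbaaa tba) tbabb) (smul 2 (br (br tbaab tba) tbaab))) (br (br tbabb tba) tbaaa)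
def T4 : Tr :=
  add (sub (add (br (br tbab tbaa) tbaab) (br (br tbaaa tbab) tbab))
    (smul 2 (br (br tbaab tbaa) tbab))) (br (br tbabb tbaa) tbaa)
def T5 : Tr :=
  add (smul (-1) (br (br (br tbaa tba) tba) tbab)) (br (br (br tbab tba) tba) tbaa)

def w1 : List Bool := [true, false, true, false, true, true, false, false, false, true]
def w2 : List Bool := [true, false, false, true, false, true, true, false, false, true]
def w3 : List Bool := [true, true, true, true, false, true, false, false, false, false]
def w4 : List Bool := [true, false, false, false, false, true, false, true, true, true]
def w5 : List Bool := [false, false, true, true, false, false, false, true, true, true]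

/-- the coordinates of an invariant with respect to the five basis elements -/
def l1 (p : Tr) : ℤ :=
  5 * coef p w1 + 13 * coef p w2 + 94 * coef p w3 - 35 * coef p w4 - 23 * coef p w5
def l2 (p : Tr) : ℤ := - coef p w3
def l3 (p : Tr) : ℤ := -6 * coef p w3 + coef p w4 - coef p w5
def l4 (p : Tr) : ℤ := -2 * coef p w3 - coef p w5
def l5 (p : Tr) : ℤ :=
  3 * coef p w1 + 8 * coef p w2 + 54 * coef p w3 - 21 * coef p w4 - 15 * coef p w5

def resid (p : Tr) : Tr :=
  sub p (add (smul (l1 p) T1) (add (smul (l2 p) T2) (add (smul (l3 p) T3)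
    (add (smul (l4 p) T4) (smul (l5 p) T5)))))


def lists : ℕ → List (List Bool)
  | 0 => [[]]
  | k + 1 => (lists k).map (List.cons false) ++ (lists k).map (List.cons true)

def om : Tr := sub (mul tA tB) (mul tB tA)
/-- `a t b - b t a` -/
def nest (t : Tr) : Tr := sub (n 0 (rB t) z) (n 0 z (rA t))

/-- the invariants of degree 8 given by noncrossing pairings, with their leading words -/
def basis8 : List (List Bool × Tr) :=
  [([false, false, false, false, true, true, true, true],
     (nest (nest (nest om)))),
   ([false, false, false, true, false, true, true, true],
     (nest (nest (mul om om)))),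
   ([false, false, false, true, true, false, true, true],
     (nest (mul (nest om) om))),
   ([false, false, false, true, true, true, false, true],
     (mul (nest (nest om)) om)),
   ([false, false, true, false, false, true, true, true],
     (nest (mul om (nest om)))),
   ([false, false, true, false, true, false, true, true],
     (nest (mul om (mul om om)))),
   ([false, false, true, false, true, true, false, true],
     (mul (nest (mul om om)) om)),
   ([false, false, true, true, false, false, true, true],
     (mul (nest om) (nest om))),
   ([false, false, true, true, false, true, false, true],
     (mul (nest om) (mul om om))),
   ([false, true, false, false, false, true, true, true],
     (mul om (nest (nest om)))),
   ([false, true, false, false, true, false, true, true],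
     (mul om (nest (mul om om)))),
   ([false, true, false, false, true, true, false, true],
     (mul om (mul (nest om) om))),
   ([false, true, false, true, false, false, true, true],
     (mul om (mul om (nest om)))),
   ([false, true, false, true, false, true, false, true],
     (mul om (mul om (mul om om))))]

/-- reduction with respect to a list of polynomials with given leading words -/
def red (t : Tr) : List (List Bool × Tr) → Bool
  | [] => isZero t
  | vN :: rest => bif isZ (coef t vN.1) then red t rest
      else red (sub t (smul (coef t vN.1) vN.2)) rest

def good (u : List Bool) : Bool :=
  if wt u = 0 then red (PT (word u)) basis8
  else decide ((wt u ^ 2 - 4) * (wt u ^ 2 - 16) * (wt u ^ 2 - 36) * (wt u ^ 2 - 64) = 0)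

set_option maxRecDepth 100000 in
theorem all_good : (lists 8).all good = true := by decide +kernel

set_option maxRecDepth 100000 in
theorem all_basis :
    basis8.all (fun vN => ok 8 vN.2 && isZero (resid (RT vN.2))) = true := by decide +kernel

end Tr

open Tr

attribute [local instance] LieRing.ofAssociativeRing
attribute [local instance] LieAlgebra.ofAssociativeAlgebra

/-- The free associative algebra. -/
abbrev FA : Type := FreeAlgebra ℂ (Fin 2)

def xA : FA := FreeAlgebra.ι ℂ 0
def xB : FA := FreeAlgebra.ι ℂ 1

/-- The canonical map of the free Lie algebra to the free associative algebra. -/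
def iL : FL →ₗ⁅ℂ⁆ FA := FreeLieAlgebra.lift ℂ (FreeAlgebra.ι ℂ)

theorem iL_A : iL genA = xA := by simp [iL, genA, xA]
theorem iL_B : iL genB = xB := by simp [iL, genB, xB]

theorem iL_lie (u v : FL) : iL ⁅u, v⁆ = iL u * iL v - iL v * iL u := by
  rw [LieHom.map_lie, LieRing.of_associative_ring_bracket]

/-! ### Semantics of trees -/

theorem isZ_spec {c : ℤ} (h : isZ c = true) : c = 0 := by
  cases c with
  | ofNat m => simp only [isZ] at h; simpa using Nat.eq_of_beq_eq_true h
  | negSucc m => simp [isZ] at h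

/-- evaluation in the free associative algebra -/
def ev : Tr → FA
  | z => 0
  | n c l r => (c : ℂ) • 1 + (xA * ev l + xB * ev r)

theorem add_z (t : Tr) : Tr.add z t = t := rfl
theorem add_n_z (c l r) : Tr.add (n c l r) z = n c l r := rfl
theorem add_n_n (c l r d l' r') :
    Tr.add (n c l r) (n d l' r') = n (c + d) (Tr.add l l') (Tr.add r r') := rfl
theorem smul_z (k) : Tr.smul k z = z := rfl
theorem smul_n (k c l r) : Tr.smul k (n c l r) = n (k * c) (Tr.smul k l) (Tr.smul k r) := rfl
theorem rA_n (c l r) : rA (n c l r) = n 0 (addC c (rA l)) (rA r) := rfl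
theorem rB_n (c l r) : rB (n c l r) = n 0 (rB l) (addC c (rB r)) := rfl
theorem isZero_n (c l r) : isZero (n c l r) = (isZ c && isZero l && isZero r) := rfl
theorem RT_n (c l r) : RT (n c l r) = Tr.add (bif isZ c then z else Tr.smul c tba)
      (Tr.add (Tr.sub (n 0 (RT l) z) (rA (RT l))) (Tr.sub (n 0 z (RT r)) (rB (RT r)))) := rfl

theorem ev_add (s t : Tr) : ev (Tr.add s t) = ev s + ev t := by
  induction s generalizing t with
  | z => simp [add_z, ev]
  | n c l r ihl ihr =>
    cases t with
    | z => simp [add_n_z, ev]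
    | n d l' r' =>
      simp only [add_n_n, ev, ihl, ihr, mul_add, Int.cast_add, add_smul]
      abel

theorem ev_smul (k : ℤ) (t : Tr) : ev (Tr.smul k t) = (k : ℂ) • ev t := by
  induction t with
  | z => simp [smul_z, ev]
  | n c l r ihl ihr =>
    simp only [smul_n, ev, ihl, ihr, smul_add, mul_smul_comm, Int.cast_mul, mul_smul]

theorem ev_sub (s t : Tr) : ev (Tr.sub s t) = ev s - ev t := by
  simp [Tr.sub, ev_add, ev_smul, sub_eq_add_neg]

theorem ev_addC (c : ℤ) (t : Tr) : ev (addC c t) = (c : ℂ) • 1 + ev t := by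
  unfold addC
  cases h : isZ c
  · simp [ev_add, ev]
  · simp [isZ_spec h]

theorem ev_rA (t : Tr) : ev (rA t) = ev t * xA := by
  induction t with
  | z => simp [rA, ev]
  | n c l r ihl ihr =>
    simp only [rA_n, ev, ev_addC, ihl, ihr, mul_add, add_mul, mul_smul_comm, smul_mul_assoc,
      mul_assoc, mul_one, one_mul, Int.cast_zero, zero_smul]
    abel

theorem ev_rB (t : Tr) : ev (rB t) = ev t * xB := by
  induction t with
  | z => simp [rB, ev]
  | n c l r ihl ihr =>
    simp only [rB_n, ev, ev_addC, ihl, ihr, mul_add, add_mul, mul_smul_comm, smul_mul_assoc,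
      mul_assoc, mul_one, one_mul, Int.cast_zero, zero_smul]
    abel

theorem ev_mul (s t : Tr) : ev (Tr.mul s t) = ev s * ev t := by
  induction s with
  | z => simp [Tr.mul, ev]
  | n c l r ihl ihr =>
    unfold Tr.mul
    cases h : isZ c
    · simp [ev_add, ev_smul, ev, ihl, ihr, add_mul, mul_assoc]
    · simp [isZ_spec h, ev, ihl, ihr, add_mul, mul_assoc]

theorem ev_br (s t : Tr) : ev (br s t) = ev s * ev t - ev t * ev s := by
  simp [br, ev_sub, ev_mul]

theorem ev_isZero {t : Tr} (h : isZero t = true) : ev t = 0 := by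
  induction t with
  | z => simp [ev]
  | n c l r ihl ihr =>
    simp only [isZero_n, Bool.and_eq_true] at h
    simp [ev, isZ_spec h.1.1, ihl h.1.2, ihr h.2]

theorem ev_tA : ev tA = xA := by simp [tA, ev]
theorem ev_tB : ev tB = xB := by simp [tB, ev]

theorem iL_br {u v : FL} {s t : Tr} (hu : iL u = ev s) (hv : iL v = ev t) :
    iL ⁅u, v⁆ = ev (br s t) := by rw [iL_lie, ev_br, hu, hv]

theorem iL_tA : iL genA = ev tA := by rw [iL_A, ev_tA]
theorem iL_tB : iL genB = ev tB := by rw [iL_B, ev_tB]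
theorem iL_ba : iL ba = ev tba := iL_br iL_tB iL_tA
theorem iL_baa : iL baa = ev tbaa := iL_br iL_ba iL_tA
theorem iL_bab : iL bab = ev tbab := iL_br iL_ba iL_tB
theorem iL_baaa : iL baaa = ev tbaaa := iL_br iL_baa iL_tA
theorem iL_baab : iL baab = ev tbaab := iL_br iL_baa iL_tB
theorem iL_babb : iL babb = ev tbabb := iL_br iL_bab iL_tB

theorem iL_J1 : iL J1 = ev T1 := iL_br (iL_br iL_bab iL_ba) (iL_br iL_baa iL_ba)

theorem iL_J2 : iL J2 = ev T2 := by
  simp only [J2, T2, map_add, map_sub, map_smul, ev_add, ev_sub, ev_smul,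
    iL_br (iL_br iL_baaa iL_tB) (iL_br iL_bab iL_ba),
    iL_br (iL_br iL_baab iL_tB) (iL_br iL_baa iL_ba),
    iL_br (iL_br iL_baab iL_tB) (iL_br iL_baaa iL_tB),
    iL_br (iL_br iL_babb iL_tB) (iL_br iL_baaa iL_tA)]
  norm_num

theorem iL_J3 : iL J3 = ev T3 := by
  simp only [J3, T3, map_add, map_sub, map_smul, ev_add, ev_sub, ev_smul,
    iL_br (iL_br iL_baaa iL_ba) iL_babb,
    iL_br (iL_br iL_baab iL_ba) iL_baab,
    iL_br (iL_br iL_babb iL_ba) iL_baaa]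
  norm_num

theorem iL_J4 : iL J4 = ev T4 := by
  simp only [J4, T4, map_add, map_sub, map_smul, ev_add, ev_sub, ev_smul,
    iL_br (iL_br iL_bab iL_baa) iL_baab,
    iL_br (iL_br iL_baaa iL_bab) iL_bab,
    iL_br (iL_br iL_baab iL_baa) iL_bab,
    iL_br (iL_br iL_babb iL_baa) iL_baa]
  norm_num

theorem iL_J5 : iL J5 = ev T5 := by
  simp only [J5, T5, map_add, map_neg, ev_add, ev_smul,
    iL_br (iL_br (iL_br iL_baa iL_ba) iL_ba) iL_bab,
    iL_br (iL_br (iL_br iL_bab iL_ba) iL_ba) iL_baa]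
  norm_num

/-! ### Coefficient functionals -/

/-- left multiplication by a letter on functions on words -/
def shiftOp (i : Bool) : Module.End ℂ (List Bool → ℂ) where
  toFun f w := match w with
    | [] => 0
    | j :: v => if i = j then f v else 0
  map_add' f g := by
    funext w; cases w <;> simp; split_ifs <;> simp
  map_smul' c f := by
    funext w; cases w <;> simp

def repW : FA →ₐ[ℂ] Module.End ℂ (List Bool → ℂ) :=
  FreeAlgebra.lift ℂ ![shiftOp false, shiftOp true]

theorem repW_A : repW xA = shiftOp false := by simp [repW, xA]
theorem repW_B : repW xB = shiftOp true := by simp [repW, xB]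

def delta : List Bool → ℂ
  | [] => 1
  | _ :: _ => 0

def cf (w : List Bool) : FA →ₗ[ℂ] ℂ :=
  (LinearMap.proj w) ∘ₗ (LinearMap.applyₗ delta) ∘ₗ repW.toLinearMap

theorem cf_apply (w : List Bool) (p : FA) : cf w p = repW p delta w := rfl

theorem cf_ev (w : List Bool) (t : Tr) : cf w (ev t) = (coef t w : ℂ) := by
  induction t generalizing w with
  | z => simp [ev, coef]
  | n c l r ihl ihr =>
    simp only [cf_apply] at ihl ihr ⊢
    simp only [ev, map_add, map_mul, map_smul, map_one, repW_A, repW_B]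
    cases w with
    | nil => simp [shiftOp, coef, delta]
    | cons i v => cases i <;> simp [shiftOp, coef, delta, ihl, ihr]

/-! ### The Dynkin operator -/

/-- the operator `(v, c) ↦ ([x, v] + c x, 0)` -/
def dynOp (x : FL) : Module.End ℂ (FL × ℂ) where
  toFun p := (⁅x, p.1⁆ + p.2 • x, 0)
  map_add' p q := by
    ext
    · simp only [Prod.fst_add, Prod.snd_add, lie_add, add_smul]; abel
    · simp
  map_smul' c p := by
    ext
    · simp [mul_smul]
    · simp

def theta : FA →ₐ[ℂ] Module.End ℂ (FL × ℂ) :=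
  FreeAlgebra.lift ℂ ![dynOp genA, dynOp genB]

theorem theta_A : theta xA = dynOp genA := by simp [theta, xA]
theorem theta_B : theta xB = dynOp genB := by simp [theta, xB]

theorem theta_magma (t : FreeMagma (Fin 2)) (v : FL) (c : ℂ) :
    theta (iL (magmaToLie t)) (v, c) =
      (⁅magmaToLie t, v⁆ + (c * t.length) • magmaToLie t, 0) := by
  induction t using FreeMagma.rec generalizing v c with
  | of i =>
    fin_cases i
    · change theta (iL genA) (v, c) = (⁅genA, v⁆ + (c * ((1 : ℕ) : ℂ)) • genA, 0)
      rw [iL_A, theta_A]; simp [dynOp]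
    · change theta (iL genB) (v, c) = (⁅genB, v⁆ + (c * ((1 : ℕ) : ℂ)) • genB, 0)
      rw [iL_B, theta_B]; simp [dynOp]
  | mul t u iht ihu =>
    change theta (iL ⁅magmaToLie t, magmaToLie u⁆) (v, c) =
      (⁅⁅magmaToLie t, magmaToLie u⁆, v⁆ + (c * ((t.length + u.length : ℕ) : ℂ)) •
        ⁅magmaToLie t, magmaToLie u⁆, 0)
    rw [iL_lie, map_sub, map_mul, map_mul, LinearMap.sub_apply, Module.End.mul_apply,
      Module.End.mul_apply, iht, ihu, iht, ihu]
    ext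
    · simp only [Prod.fst_sub, lie_add, lie_smul, zero_mul, zero_smul, add_zero]
      rw [lie_lie, ← lie_skew (magmaToLie t) (magmaToLie u)]
      push_cast
      module
    · simp

theorem theta_homog {k : ℕ} {v : FL} (hv : v ∈ homog k) :
    theta (iL v) (0, 1) = ((k : ℂ) • v, 0) := by
  unfold homog at hv
  induction hv using Submodule.span_induction with
  | mem x hx =>
    obtain ⟨t, ht, rfl⟩ := hx
    rw [theta_magma]
    simp only [Set.mem_ofPred_eq] at ht
    simp [ht]
  | zero => simp only [map_zero, LinearMap.zero_apply, smul_zero]; rfl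
  | add x y _ _ hx hy =>
    simp only [map_add, LinearMap.add_apply, hx, hy, Prod.mk_add_mk, smul_add, add_zero]
  | smul c x _ hx =>
    simp only [map_smul, LinearMap.smul_apply, hx, Prod.smul_mk, smul_zero]
    rw [smul_comm]

theorem iL_inj {v : FL} (hv : v ∈ homog 10) (h : iL v = 0) : v = 0 := by
  have := theta_homog hv
  rw [h] at this
  simp only [map_zero, LinearMap.zero_apply] at this
  have h2 := congrArg Prod.fst this
  simpa using h2.symm

/-! ### Homogeneous components -/

theorem homog_A : genA ∈ homog 1 := Submodule.subset_span ⟨.of 0, rfl, rfl⟩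
theorem homog_B : genB ∈ homog 1 := Submodule.subset_span ⟨.of 1, rfl, rfl⟩

theorem homog_lie {i j : ℕ} {u v : FL} (hu : u ∈ homog i) (hv : v ∈ homog j) :
    ⁅u, v⁆ ∈ homog (i + j) := by
  unfold homog at hu
  induction hu using Submodule.span_induction with
  | zero => simp
  | add x y _ _ hx hy => rw [add_lie]; exact add_mem hx hy
  | smul c x _ hx => rw [smul_lie]; exact Submodule.smul_mem _ _ hx
  | mem x hx =>
    obtain ⟨t, ht, rfl⟩ := hx
    unfold homog at hv
    induction hv using Submodule.span_induction with
    | zero => simp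
    | add x y _ _ hx hy => rw [lie_add]; exact add_mem hx hy
    | smul c x _ hx => rw [lie_smul]; exact Submodule.smul_mem _ _ hx
    | mem y hy =>
      obtain ⟨u, hu, rfl⟩ := hy
      refine Submodule.subset_span ⟨.mul t u, ?_, rfl⟩
      simp only [Set.mem_ofPred_eq] at ht hu ⊢
      change t.length + u.length = _
      rw [ht, hu]

theorem homog_ba : ba ∈ homog 2 := by
  have h := homog_lie homog_B homog_A
  exact h
theorem homog_baa : baa ∈ homog 3 := by
  have h := homog_lie homog_ba homog_A
  exact h
theorem homog_bab : bab ∈ homog 3 := by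
  have h := homog_lie homog_ba homog_B
  exact h
theorem homog_baaa : baaa ∈ homog 4 := by
  have h := homog_lie homog_baa homog_A
  exact h
theorem homog_baab : baab ∈ homog 4 := by
  have h := homog_lie homog_baa homog_B
  exact h
theorem homog_babb : babb ∈ homog 4 := by
  have h := homog_lie homog_bab homog_B
  exact h

theorem lie_ten {i j : ℕ} {u v : FL} (hu : u ∈ homog i) (hv : v ∈ homog j) (h : i + j = 10) :
    ⁅u, v⁆ ∈ homog 10 := h ▸ homog_lie hu hv

theorem homog_J1 : J1 ∈ homog 10 := by
  unfold J1
  exact lie_ten (homog_lie homog_bab homog_ba) (homog_lie homog_baa homog_ba) rfl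

theorem homog_J2 : J2 ∈ homog 10 := by
  unfold J2
  exact add_mem (sub_mem (sub_mem
    (lie_ten (homog_lie homog_baaa homog_B) (homog_lie homog_bab homog_ba) rfl)
    (Submodule.smul_mem _ _
      (lie_ten (homog_lie homog_baab homog_B) (homog_lie homog_baa homog_ba) rfl)))
    (Submodule.smul_mem _ _
      (lie_ten (homog_lie homog_baab homog_B) (homog_lie homog_baaa homog_B) rfl)))
    (lie_ten (homog_lie homog_babb homog_B) (homog_lie homog_baaa homog_A) rfl)

theorem homog_J3 : J3 ∈ homog 10 := by
  unfold J3
  exact add_mem (sub_mem (lie_ten (homog_lie homog_baaa homog_ba) homog_babb rfl)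
    (Submodule.smul_mem _ _ (lie_ten (homog_lie homog_baab homog_ba) homog_baab rfl)))
    (lie_ten (homog_lie homog_babb homog_ba) homog_baaa rfl)

theorem homog_J4 : J4 ∈ homog 10 := by
  unfold J4
  exact add_mem (sub_mem (add_mem (lie_ten (homog_lie homog_bab homog_baa) homog_baab rfl)
    (lie_ten (homog_lie homog_baaa homog_bab) homog_bab rfl))
    (Submodule.smul_mem _ _ (lie_ten (homog_lie homog_baab homog_baa) homog_bab rfl)))
    (lie_ten (homog_lie homog_babb homog_baa) homog_baa rfl)

theorem homog_J5 : J5 ∈ homog 10 := by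
  unfold J5
  exact add_mem (neg_mem
    (lie_ten (homog_lie (homog_lie homog_baa homog_ba) homog_ba) homog_bab rfl))
    (lie_ten (homog_lie (homog_lie homog_bab homog_ba) homog_ba) homog_baa rfl)

/-! ### Right-normed brackets -/

/-- combination of right-normed brackets ending in `[b,a]` -/
def R : Tr → FL
  | z => 0
  | n c l r => (c : ℂ) • ba + (⁅genA, R l⁆ + ⁅genB, R r⁆)

theorem R_add (s t : Tr) : R (Tr.add s t) = R s + R t := by
  induction s generalizing t with
  | z => simp [add_z, R]
  | n c l r ihl ihr =>
    cases t with
    | z => simp [add_n_z, R]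
    | n d l' r' =>
      simp only [add_n_n, R, ihl, ihr, lie_add, Int.cast_add, add_smul]
      abel

theorem R_smul (k : ℤ) (t : Tr) : R (Tr.smul k t) = (k : ℂ) • R t := by
  induction t with
  | z => simp [smul_z, R]
  | n c l r ihl ihr =>
    simp only [smul_n, R, ihl, ihr, smul_add, lie_smul, Int.cast_mul, mul_smul]

theorem R_sub (s t : Tr) : R (Tr.sub s t) = R s - R t := by
  simp [Tr.sub, R_add, R_smul, sub_eq_add_neg]

theorem R_isZero {t : Tr} (h : isZero t = true) : R t = 0 := by
  induction t with
  | z => simp [R]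
  | n c l r ihl ihr =>
    simp only [isZero_n, Bool.and_eq_true] at h
    simp [R, isZ_spec h.1.1, ihl h.1.2, ihr h.2]

theorem iL_R (t : Tr) : iL (R t) = ev (RT t) := by
  induction t with
  | z => simp [R, RT, ev]
  | n c l r ihl ihr =>
    have h1 : ev (bif isZ c then z else Tr.smul c tba) = (c : ℂ) • ev tba := by
      cases h : isZ c
      · simp [ev_smul]
      · simp [isZ_spec h, ev]
    rw [RT_n, ev_add, h1]
    simp only [R, map_add, map_smul, iL_ba, iL_lie, iL_A, iL_B, ihl, ihr, ev_add, ev_sub, ev_rA,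
      ev_rB, ev]
    simp

theorem R_homog {k : ℕ} {t : Tr} (h : ok k t = true) : R t ∈ homog (k + 2) := by
  induction t generalizing k with
  | z => simp [R]
  | n c l r ihl ihr =>
    cases k with
    | zero =>
      simp only [ok, Bool.and_eq_true] at h
      simp only [R, R_isZero h.1, R_isZero h.2, lie_zero, add_zero]
      exact Submodule.smul_mem _ _ homog_ba
    | succ k =>
      simp only [ok, Bool.and_eq_true] at h
      have e : k + 1 + 2 = 1 + (k + 2) := by ring
      simp only [R, isZ_spec h.1.1, Int.cast_zero, zero_smul, zero_add]
      rw [e]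
      exact add_mem (homog_lie homog_A (ihl h.1.2)) (homog_lie homog_B (ihr h.2))

/-- the spans of right-normed brackets -/
def V : ℕ → Submodule ℂ FL
  | 0 => ⊥
  | 1 => Submodule.span ℂ {genA, genB}
  | k + 2 => Submodule.span ℂ ((fun u => R (word u)) '' {u | u.length = k})

theorem R_word_nil : R (word []) = ba := by simp [word, R]
theorem R_word_false (u) : R (word (false :: u)) = ⁅genA, R (word u)⁆ := by simp [word, R]
theorem R_word_true (u) : R (word (true :: u)) = ⁅genB, R (word u)⁆ := by simp [word, R]

theorem ba_mem : ba ∈ V 2 := Submodule.subset_span ⟨[], rfl, R_word_nil⟩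

theorem V_gen {g : FL} (hg : g = genA ∨ g = genB) {k : ℕ} {v : FL} (hv : v ∈ V k) :
    ⁅g, v⁆ ∈ V (k + 1) := by
  match k with
  | 0 =>
    have : v = 0 := by simpa [V] using hv
    simp [this]
  | 1 =>
    simp only [V] at hv
    rw [Submodule.mem_span_pair] at hv
    obtain ⟨c, d, rfl⟩ := hv
    have e : ⁅genA, genB⁆ = -ba := by rw [ba, lie_skew]
    rcases hg with rfl | rfl
    · rw [lie_add, lie_smul, lie_smul, lie_self, e]
      exact add_mem (by simp) (Submodule.smul_mem _ _ (neg_mem ba_mem))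
    · rw [lie_add, lie_smul, lie_smul, lie_self]
      exact add_mem (Submodule.smul_mem _ _ ba_mem) (by simp)
  | k + 2 =>
    simp only [V] at hv
    induction hv using Submodule.span_induction with
    | zero => simp
    | add x y _ _ hx hy => rw [lie_add]; exact add_mem hx hy
    | smul c x _ hx => rw [lie_smul]; exact Submodule.smul_mem _ _ hx
    | mem x hx =>
      obtain ⟨u, hu, rfl⟩ := hx
      simp only [Set.mem_ofPred_eq] at hu
      rcases hg with rfl | rfl
      · exact Submodule.subset_span ⟨false :: u, by simp [hu], R_word_false u⟩
      · exact Submodule.subset_span ⟨true :: u, by simp [hu], R_word_true u⟩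

theorem V_magma (t : FreeMagma (Fin 2)) {k : ℕ} {v : FL} (hv : v ∈ V k) :
    ⁅magmaToLie t, v⁆ ∈ V (k + t.length) := by
  induction t using FreeMagma.rec generalizing k v with
  | of i =>
    fin_cases i
    · exact V_gen (Or.inl rfl) hv
    · exact V_gen (Or.inr rfl) hv
  | mul t u iht ihu =>
    change ⁅⁅magmaToLie t, magmaToLie u⁆, v⁆ ∈ V (k + (t.length + u.length))
    rw [lie_lie]
    refine sub_mem ?_ ?_
    · have := iht (ihu hv)
      rwa [show k + u.length + t.length = k + (t.length + u.length) by ring] at this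
    · have := ihu (iht hv)
      rwa [add_assoc] at this

theorem magma_V (t : FreeMagma (Fin 2)) : magmaToLie t ∈ V t.length := by
  induction t using FreeMagma.rec with
  | of i =>
    fin_cases i
    · exact Submodule.subset_span (Or.inl rfl)
    · exact Submodule.subset_span (Or.inr rfl)
  | mul t u iht ihu =>
    have := V_magma t ihu
    rw [add_comm] at this
    exact this

theorem homog_le_V : homog 10 ≤ V 10 := by
  refine Submodule.span_le.2 ?_
  rintro _ ⟨t, ht, rfl⟩
  simp only [Set.mem_ofPred_eq] at ht
  rw [← ht]
  exact magma_V t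

theorem mem_lists (u : List Bool) : u ∈ lists u.length := by
  induction u with
  | nil => simp [lists]
  | cons i u ih => cases i <;> simp [lists, ih]

/-! ### The span of the five invariants -/

def SJ : Submodule ℂ FL := Submodule.span ℂ {J1, J2, J3, J4, J5}

theorem J1_mem : J1 ∈ SJ := Submodule.subset_span (by simp)
theorem J2_mem : J2 ∈ SJ := Submodule.subset_span (by simp)
theorem J3_mem : J3 ∈ SJ := Submodule.subset_span (by simp)
theorem J4_mem : J4 ∈ SJ := Submodule.subset_span (by simp)
theorem J5_mem : J5 ∈ SJ := Submodule.subset_span (by simp)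

theorem R_mem_of_resid {t : Tr} (h1 : ok 8 t = true) (h2 : isZero (resid (RT t)) = true) :
    R t ∈ SJ := by
  have h3 := ev_isZero h2
  unfold resid at h3
  simp only [ev_sub, ev_add, ev_smul, ← iL_R, ← iL_J1, ← iL_J2, ← iL_J3, ← iL_J4, ← iL_J5] at h3
  generalize l1 (RT t) = c1 at h3
  generalize l2 (RT t) = c2 at h3
  generalize l3 (RT t) = c3 at h3
  generalize l4 (RT t) = c4 at h3
  generalize l5 (RT t) = c5 at h3
  simp only [← map_smul, ← map_add, ← map_sub] at h3
  have h4 := iL_inj (sub_mem (R_homog h1) (add_mem (Submodule.smul_mem _ _ homog_J1)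
    (add_mem (Submodule.smul_mem _ _ homog_J2) (add_mem (Submodule.smul_mem _ _ homog_J3)
    (add_mem (Submodule.smul_mem _ _ homog_J4) (Submodule.smul_mem _ _ homog_J5)))))) h3
  rw [sub_eq_zero.1 h4]
  exact (add_mem (Submodule.smul_mem _ _ J1_mem)
    (add_mem (Submodule.smul_mem _ _ J2_mem) (add_mem (Submodule.smul_mem _ _ J3_mem)
    (add_mem (Submodule.smul_mem _ _ J4_mem) (Submodule.smul_mem _ _ J5_mem)))))

theorem R_mem_of_red (L : List (List Bool × Tr)) (hL : ∀ vN ∈ L, R vN.2 ∈ SJ) (t : Tr)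
    (h : red t L = true) : R t ∈ SJ := by
  induction L generalizing t with
  | nil =>
    have : R t = 0 := R_isZero h
    simp [this]
  | cons vN L ih =>
    have hL' : ∀ vN ∈ L, R vN.2 ∈ SJ := fun x hx => hL x (List.mem_cons_of_mem _ hx)
    unfold red at h
    cases hc : isZ (coef t vN.1)
    · rw [hc, cond_false] at h
      have h2 := ih hL' _ h
      rw [R_sub, R_smul] at h2
      have h3 := add_mem h2 (Submodule.smul_mem _ ((coef t vN.1 : ℤ) : ℂ)
        (hL vN List.mem_cons_self))
      simpa using h3
    · rw [hc, cond_true] at h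
      exact ih hL' _ h

theorem R_PT_mem {u : List Bool} (hu : u.length = 8) (hw : wt u = 0) : R (PT (word u)) ∈ SJ := by
  have h := List.all_eq_true.1 all_good u (hu ▸ mem_lists u)
  unfold good at h
  rw [if_pos hw] at h
  refine R_mem_of_red basis8 (fun vN hN => ?_) _ h
  have h2 := List.all_eq_true.1 all_basis vN hN
  rw [Bool.and_eq_true] at h2
  exact R_mem_of_resid h2.1 h2.2

theorem wt_poly {u : List Bool} (hu : u.length = 8) (hw : wt u ≠ 0) :
    (wt u ^ 2 - 4) * (wt u ^ 2 - 16) * (wt u ^ 2 - 36) * (wt u ^ 2 - 64) = 0 := by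
  have h := List.all_eq_true.1 all_good u (hu ▸ mem_lists u)
  unfold good at h
  rw [if_neg hw] at h
  exact of_decide_eq_true h

/-! ### The sl₂ action -/

section action

variable {X H Y : LieDerivation ℂ FL FL}

theorem der_lie (D : LieDerivation ℂ FL FL) (u v : FL) : D ⁅u, v⁆ = ⁅u, D v⁆ + ⁅D u, v⁆ := by
  rw [LieDerivation.apply_lie_eq_add]

theorem X_R (hXa : X genA = 0) (hXb : X genB = genA) (t : Tr) : X (R t) = R (XT t) := by
  induction t with
  | z => simp [R, XT]
  | n c l r ihl ihr =>
    simp only [R, XT, ba, map_add, map_smul, der_lie, hXa, hXb, ihl, ihr, R_add, lie_add,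
      lie_zero, zero_lie, lie_self, smul_zero, Int.cast_zero, zero_smul, add_zero, zero_add]
    abel

theorem Y_R (hYa : Y genA = genB) (hYb : Y genB = 0) (t : Tr) : Y (R t) = R (YT t) := by
  induction t with
  | z => simp [R, YT]
  | n c l r ihl ihr =>
    simp only [R, YT, ba, map_add, map_smul, der_lie, hYa, hYb, ihl, ihr, R_add, lie_add,
      lie_zero, zero_lie, lie_self, smul_zero, Int.cast_zero, zero_smul, add_zero, zero_add]
    abel

theorem H_R (hHa : H genA = genA) (hHb : H genB = -genB) (u : List Bool) :
    H (R (word u)) = (wt u : ℂ) • R (word u) := by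
  induction u with
  | nil => simp [R_word_nil, ba, der_lie, hHa, hHb, wt]
  | cons i u ih =>
    cases i
    · rw [R_word_false, der_lie, ih, hHa]
      simp only [lie_smul, wt, Int.cast_add, Int.cast_one]
      module
    · rw [R_word_true, der_lie, ih, hHb]
      simp only [lie_smul, wt, Int.cast_add, Int.cast_neg, Int.cast_one, neg_lie]
      module

theorem G_n (c : ℤ) (l r : Tr) : theta (ev (n c l r)) (0, 1) =
    (c : ℂ) • ((0 : FL), (1 : ℂ)) + (dynOp genA (theta (ev l) (0, 1)) +
      dynOp genB (theta (ev r) (0, 1))) := by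
  simp only [ev, map_add, map_smul, map_mul, map_one, theta_A, theta_B]
  rfl

theorem G_add (s t : Tr) : theta (ev (Tr.add s t)) (0, 1) =
    theta (ev s) (0, 1) + theta (ev t) (0, 1) := by
  rw [ev_add, map_add]; rfl

theorem G_sub (s t : Tr) : theta (ev (Tr.sub s t)) (0, 1) =
    theta (ev s) (0, 1) - theta (ev t) (0, 1) := by
  rw [ev_sub, map_sub]; rfl

theorem X_G (hXa : X genA = 0) (hXb : X genB = genA) (t : Tr) :
    (X (theta (ev t) (0, 1)).1, (0 : ℂ)) = theta (ev (XT t)) (0, 1) := by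
  induction t with
  | z => simp [ev, XT]
  | n c l r ihl ihr =>
    simp only [XT]
    rw [G_n, G_n, G_add, ← ihl, ← ihr]
    ext
    · simp [-LieDerivation.apply_lie_eq_sub, dynOp, der_lie, hXa, hXb]
      abel
    · simp [dynOp]

theorem Y_G (hYa : Y genA = genB) (hYb : Y genB = 0) (t : Tr) :
    (Y (theta (ev t) (0, 1)).1, (0 : ℂ)) = theta (ev (YT t)) (0, 1) := by
  induction t with
  | z => simp [ev, YT]
  | n c l r ihl ihr =>
    simp only [YT]
    rw [G_n, G_n, G_add, ← ihl, ← ihr]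
    ext
    · simp [-LieDerivation.apply_lie_eq_sub, dynOp, der_lie, hYa, hYb]
      abel
    · simp [dynOp]

theorem H_G (hHa : H genA = genA) (hHb : H genB = -genB) (t : Tr) :
    (H (theta (ev t) (0, 1)).1, (0 : ℂ)) = theta (ev (HT t)) (0, 1) := by
  induction t with
  | z => simp [ev, HT]
  | n c l r ihl ihr =>
    simp only [HT]
    rw [G_n, G_n, G_add, G_sub, ← ihl, ← ihr]
    ext
    · simp [-LieDerivation.apply_lie_eq_sub, -lie_skew, dynOp, der_lie, hHa, hHb]
      abel
    · simp [dynOp]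

theorem inv_of_tree (hXa : X genA = 0) (hXb : X genB = genA)
    (hHa : H genA = genA) (hHb : H genB = -genB)
    (hYa : Y genA = genB) (hYb : Y genB = 0) {v : FL} {t : Tr} (hv : v ∈ homog 10)
    (ht : iL v = ev t) (hc : (isZero (XT t) && isZero (HT t) && isZero (YT t)) = true) :
    v ∈ invariants X H Y 10 := by
  have h := theta_homog hv
  rw [ht] at h
  simp only [Bool.and_eq_true] at hc
  have hx := X_G hXa hXb t
  have hh := H_G hHa hHb t
  have hy := Y_G hYa hYb t
  rw [ev_isZero hc.1.1, h] at hx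
  rw [ev_isZero hc.1.2, h] at hh
  rw [ev_isZero hc.2, h] at hy
  simp only [map_zero, LinearMap.zero_apply, Prod.mk_eq_zero, map_smul, and_true,
    smul_eq_zero] at hx hh hy
  refine ⟨⟨⟨hv, ?_⟩, ?_⟩, ?_⟩
  · exact hx.resolve_left (by norm_num)
  · exact hh.resolve_left (by norm_num)
  · exact hy.resolve_left (by norm_num)

set_option maxRecDepth 100000 in
theorem J_check : [T1, T2, T3, T4, T5].all
    (fun t => isZero (XT t) && isZero (HT t) && isZero (YT t)) = true := by decide +kernel

theorem SJ_le (hXa : X genA = 0) (hXb : X genB = genA)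
    (hHa : H genA = genA) (hHb : H genB = -genB)
    (hYa : Y genA = genB) (hYb : Y genB = 0) : SJ ≤ invariants X H Y 10 := by
  have hJ := List.all_eq_true.1 J_check
  refine Submodule.span_le.2 ?_
  rintro v (rfl | rfl | rfl | rfl | rfl)
  · exact inv_of_tree hXa hXb hHa hHb hYa hYb homog_J1 iL_J1 (hJ _ (by simp))
  · exact inv_of_tree hXa hXb hHa hHb hYa hYb homog_J2 iL_J2 (hJ _ (by simp))
  · exact inv_of_tree hXa hXb hHa hHb hYa hYb homog_J3 iL_J3 (hJ _ (by simp))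
  · exact inv_of_tree hXa hXb hHa hHb hYa hYb homog_J4 iL_J4 (hJ _ (by simp))
  · exact inv_of_tree hXa hXb hHa hHb hYa hYb homog_J5 iL_J5 (hJ _ (by simp))

/-- the extremal projector, scaled -/
def projP (X Y : FL →ₗ[ℂ] FL) : Module.End ℂ FL :=
  (2880 : ℂ) • LinearMap.id + ((-1440 : ℂ) • (Y ∘ₗ X) + ((240 : ℂ) • (Y ∘ₗ Y ∘ₗ X ∘ₗ X) +
    ((-20 : ℂ) • (Y ∘ₗ Y ∘ₗ Y ∘ₗ X ∘ₗ X ∘ₗ X) + Y ∘ₗ Y ∘ₗ Y ∘ₗ Y ∘ₗ X ∘ₗ X ∘ₗ X ∘ₗ X)))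

/-- a factor of the projection to weight zero -/
def fac (H : FL →ₗ[ℂ] FL) (k : ℂ) : Module.End ℂ FL := H ∘ₗ H - k • LinearMap.id

theorem fac_apply {H : FL →ₗ[ℂ] FL} {w : ℂ} {v : FL} (hv : H v = w • v) (k : ℂ) :
    fac H k v = (w ^ 2 - k) • v := by
  simp only [fac, LinearMap.sub_apply, LinearMap.comp_apply, hv, map_smul, LinearMap.smul_apply,
    LinearMap.id_apply]
  module

def projH (H : FL →ₗ[ℂ] FL) : Module.End ℂ FL := fac H 4 ∘ₗ fac H 16 ∘ₗ fac H 36 ∘ₗ fac H 64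

theorem projH_apply {H : FL →ₗ[ℂ] FL} {w : ℂ} {v : FL} (hv : H v = w • v) :
    projH H v = ((w ^ 2 - 4) * (w ^ 2 - 16) * (w ^ 2 - 36) * (w ^ 2 - 64)) • v := by
  simp only [projH, LinearMap.comp_apply, fac_apply hv, map_smul]
  module

theorem le_SJ (hXa : X genA = 0) (hXb : X genB = genA)
    (hHa : H genA = genA) (hHb : H genB = -genB)
    (hYa : Y genA = genB) (hYb : Y genB = 0) : invariants X H Y 10 ≤ SJ := by
  rintro v ⟨⟨⟨hv, hx⟩, hh⟩, -⟩
  have hx : X.toLinearMap v = 0 := hx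
  have hh : H.toLinearMap v = 0 := hh
  have key : V 10 ≤ SJ.comap (projP X.toLinearMap Y.toLinearMap ∘ₗ projH H.toLinearMap) := by
    refine Submodule.span_le.2 ?_
    rintro _ ⟨u, hu, rfl⟩
    simp only [Set.mem_ofPred_eq] at hu
    have h1 : H.toLinearMap (R (word u)) = (wt u : ℂ) • R (word u) := H_R hHa hHb u
    simp only [SetLike.mem_coe, Submodule.mem_comap, LinearMap.comp_apply, projH_apply h1,
      map_smul]
    by_cases hw : wt u = 0
    · refine Submodule.smul_mem _ _ ?_
      have h2 := R_PT_mem hu hw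
      have hX : ∀ t, X.toLinearMap (R t) = R (XT t) := X_R hXa hXb
      have hY : ∀ t, Y.toLinearMap (R t) = R (YT t) := Y_R hYa hYb
      convert h2 using 1
      simp only [projP, PT, LinearMap.add_apply, LinearMap.smul_apply, LinearMap.comp_apply,
        LinearMap.id_apply, hX, hY, R_add, R_smul]
      norm_num
    · have h3 := congrArg (Int.cast : ℤ → ℂ) (wt_poly hu hw)
      push_cast at h3
      rw [h3, zero_smul]
      exact zero_mem _
  have h4 := key (homog_le_V hv)
  have h5 : H.toLinearMap v = (0 : ℂ) • v := by rw [hh, zero_smul]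
  simp only [Submodule.mem_comap, LinearMap.comp_apply, projH_apply h5, map_smul] at h4
  have h6 : projP X.toLinearMap Y.toLinearMap v = (2880 : ℂ) • v := by
    simp only [projP, LinearMap.add_apply, LinearMap.smul_apply, LinearMap.comp_apply,
      LinearMap.id_apply, hx, map_zero, smul_zero, add_zero]
  rw [h6, smul_smul] at h4
  exact (Submodule.smul_mem_iff _ (by norm_num)).1 h4

end action

/-! ### Linear independence -/

set_option maxRecDepth 100000 in
theorem coef_check : [w1, w2, w3, w4, w5].map (fun w => [T1, T2, T3, T4, T5].map
    (fun t => coef t w)) = [[8, 0, 7, 4, -13], [-3, 0, 0, -6, 5], [0, -1, 0, 0, 0],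
      [0, -4, 1, -1, 0], [0, 2, 0, -1, 0]] := by decide +kernel

theorem linInd : LinearIndependent ℂ ![J1, J2, J3, J4, J5] := by
  rw [Fintype.linearIndependent_iff]
  intro g hg
  simp only [Fin.sum_univ_five] at hg
  replace hg : g 0 • J1 + g 1 • J2 + g 2 • J3 + g 3 • J4 + g 4 • J5 = 0 := hg
  have h := congrArg iL hg
  simp only [map_add, map_smul, iL_J1, iL_J2, iL_J3, iL_J4, iL_J5, map_zero] at h
  have hw : ∀ w, g 0 * coef T1 w + g 1 * coef T2 w + g 2 * coef T3 w + g 3 * coef T4 w +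
      g 4 * coef T5 w = 0 := by
    intro w
    have := congrArg (cf w) h
    simpa only [map_add, map_smul, cf_ev, map_zero, smul_eq_mul] using this
  have hc := coef_check
  simp only [List.map_cons, List.map_nil, List.cons.injEq, and_true] at hc
  obtain ⟨⟨a1, a2, a3, a4, a5⟩, ⟨b1, b2, b3, b4, b5⟩, ⟨c1, c2, c3, c4, c5⟩, ⟨d1, d2, d3, d4, d5⟩,
    ⟨e1, e2, e3, e4, e5⟩⟩ := hc
  have k1 := hw w1
  have k2 := hw w2
  have k3 := hw w3
  have k4 := hw w4
  have k5 := hw w5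
  rw [a1, a2, a3, a4, a5] at k1
  rw [b1, b2, b3, b4, b5] at k2
  rw [c1, c2, c3, c4, c5] at k3
  rw [d1, d2, d3, d4, d5] at k4
  rw [e1, e2, e3, e4, e5] at k5
  push_cast at k1 k2 k3 k4 k5
  intro i
  fin_cases i
  · change g 0 = 0
    linear_combination 5 * k1 + 13 * k2 + 94 * k3 - 35 * k4 - 23 * k5
  · change g 1 = 0
    linear_combination -k3
  · change g 2 = 0
    linear_combination -6 * k3 + k4 - k5
  · change g 3 = 0
    linear_combination -2 * k3 - k5
  · change g 4 = 0
    linear_combination 3 * k1 + 8 * k2 + 54 * k3 - 21 * k4 - 15 * k5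

/-- For the natural representation of sl₂(ℂ) on the free Lie algebra on `a, b`, the
space of Lie invariants of degree 10 has dimension 5, with basis
`J₁₀⁽¹⁾, …, J₁₀⁽⁵⁾`. -/
theorem invariants_degree_ten
    (X H Y : LieDerivation ℂ FL FL)
    (hXa : X genA = 0) (hXb : X genB = genA)
    (hHa : H genA = genA) (hHb : H genB = -genB)
    (hYa : Y genA = genB) (hYb : Y genB = 0) :
    LinearIndependent ℂ ![J1, J2, J3, J4, J5] ∧
    invariants X H Y 10 = Submodule.span ℂ {J1, J2, J3, J4, J5} := by
  exact ⟨linInd, le_antisymm (le_SJ hXa hXb hHa hHb hYa hYb)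
    (SJ_le hXa hXb hHa hHb hYa hYb)⟩
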